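/- arXiv:1707.09343 — 9 statements merged into one kernel-verified Lean document; each statement's English description precedes it below -/
import Mathlib

section
/- Let V be a real vector space of finite dimension n ≥ 2, g a nondegenerate symmetric bilinear form on V, ξ ∈ V with g(ξ,ξ) = -1, and η the linear functional η(X) := g(X,ξ). Let α, λ, μ be real numbers and Dα, Dλ, Dμ linear functionals on V (the differentials of α, λ, μ). Define T(X;Y,Z) := -(Dα+Dλ)(X)g(Y,Z) - (Dα+Dμ)(X)η(Y)η(Z) - α(α+μ)[g(X,Y)η(Z) + g(X,Z)η(Y) + 2η(X)η(Y)η(Z)]. If T(X;Y,Z) = 0 for all X,Y,Z ∈ V, then Dλ = Dμ. -/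
/-- With `T(X;Y,Z) := -(Dα+Dλ)(X)g(Y,Z) - (Dα+Dμ)(X)η(Y)η(Z)
- α(α+μ)[g(X,Y)η(Z) + g(X,Z)η(Y) + 2η(X)η(Y)η(Z)]`, if `T ≡ 0` then `Dλ = Dμ`. -/
theorem stmt_2 (V : Type*) [AddCommGroup V] [Module ℝ V] [FiniteDimensional ℝ V]
    (n : ℕ) (hn : 2 ≤ n) (hdim : Module.finrank ℝ V = n)
    (g : LinearMap.BilinForm ℝ V)
    (hg_symm : ∀ X Y : V, g X Y = g Y X)
    (hg_nd : ∀ X : V, (∀ Y : V, g X Y = 0) → X = 0)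
    (ξ : V) (hξ : g ξ ξ = -1)
    (η : V → ℝ) (hη : ∀ X, η X = g X ξ)
    (α lam mu : ℝ)
    (Dα Dlam Dmu : V →ₗ[ℝ] ℝ)
    (T : V → V → V → ℝ)
    (hT : ∀ X Y Z, T X Y Z =
      -(Dα X + Dlam X) * g Y Z - (Dα X + Dmu X) * η Y * η Z
      - α * (α + mu) * (g X Y * η Z + g X Z * η Y + 2 * η X * η Y * η Z))
    (hzero : ∀ X Y Z, T X Y Z = 0) :
    Dlam = Dmu := by
  ext X
  have h := hzero X ξ ξ
  rw [hT, hη X, hη ξ, hξ] at h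
  linarith
end

section
/- Let V be a real vector space of finite dimension n ≥ 2, g a nondegenerate symmetric bilinear form on V, ξ ∈ V with g(ξ,ξ) = -1, and η the linear functional η(X) := g(X,ξ). Let α, λ, μ be real numbers and Dα, Dλ, Dμ linear functionals on V (the differentials of α, λ, μ). Define T(X;Y,Z) := -(Dα+Dλ)(X)g(Y,Z) - (Dα+Dμ)(X)η(Y)η(Z) - α(α+μ)[g(X,Y)η(Z) + g(X,Z)η(Y) + 2η(X)η(Y)η(Z)] and S(Y,Z) := -(α+λ)g(Y,Z) - (α+μ)η(Y)η(Z). If T(X;Y,Z) = η(X)·S(Y,Z) for all X,Y,Z ∈ V, then Dλ - Dμ = (λ-μ)·η. -/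
/-- With `T` as in the η-recurrence setting and
`S(Y,Z) := -(α+λ)g(Y,Z) - (α+μ)η(Y)η(Z)`, if `T(X;Y,Z) = η(X)·S(Y,Z)` for all `X,Y,Z`,
then `Dλ - Dμ = (λ-μ)·η`. -/
theorem stmt_3 (V : Type*) [AddCommGroup V] [Module ℝ V] [FiniteDimensional ℝ V]
    (n : ℕ) (hn : 2 ≤ n) (hdim : Module.finrank ℝ V = n)
    (g : LinearMap.BilinForm ℝ V)
    (hg_symm : ∀ X Y : V, g X Y = g Y X)
    (hg_nd : ∀ X : V, (∀ Y : V, g X Y = 0) → X = 0)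
    (ξ : V) (hξ : g ξ ξ = -1)
    (η : V → ℝ) (hη : ∀ X, η X = g X ξ)
    (α lam mu : ℝ)
    (Dα Dlam Dmu : V →ₗ[ℝ] ℝ)
    (T : V → V → V → ℝ)
    (hT : ∀ X Y Z, T X Y Z =
      -(Dα X + Dlam X) * g Y Z - (Dα X + Dmu X) * η Y * η Z
      - α * (α + mu) * (g X Y * η Z + g X Z * η Y + 2 * η X * η Y * η Z))
    (S : V → V → ℝ)
    (hS : ∀ Y Z, S Y Z = -(α + lam) * g Y Z - (α + mu) * η Y * η Z)
    (hrec : ∀ X Y Z, T X Y Z = η X * S Y Z) :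
    ∀ X, Dlam X - Dmu X = (lam - mu) * η X := by
  intro X
  have hξη : η ξ = -1 := (hη ξ).trans hξ
  have h := hrec X ξ ξ
  rw [hT, hS, hξ, hξη, ← hη X] at h
  linear_combination h
end

section
/- Let V be a real vector space of finite dimension n ≥ 2, g a nondegenerate symmetric bilinear form on V, ξ ∈ V with g(ξ,ξ) = -1, and η the linear functional η(X) := g(X,ξ). Let α, λ, μ be real numbers and Dα, Dλ, Dμ linear functionals on V (the differentials of α, λ, μ). Define T(X;Y,Z) := -(Dα+Dλ)(X)g(Y,Z) - (Dα+Dμ)(X)η(Y)η(Z) - α(α+μ)[g(X,Y)η(Z) + g(X,Z)η(Y) + 2η(X)η(Y)η(Z)]. If T(X;Y,Z) = T(Y;X,Z) for all X,Y,Z ∈ V, then (Dλ-Dμ)(X)η(Y) = (Dλ-Dμ)(Y)η(X) for all X,Y ∈ V. -/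
/-- With `T` as before, if `T(X;Y,Z) = T(Y;X,Z)` for all `X,Y,Z`
(Codazzi condition), then `(Dλ-Dμ)(X)η(Y) = (Dλ-Dμ)(Y)η(X)` for all `X,Y`. -/
theorem stmt_4 (V : Type*) [AddCommGroup V] [Module ℝ V] [FiniteDimensional ℝ V]
    (n : ℕ) (hn : 2 ≤ n) (hdim : Module.finrank ℝ V = n)
    (g : LinearMap.BilinForm ℝ V)
    (hg_symm : ∀ X Y : V, g X Y = g Y X)
    (hg_nd : ∀ X : V, (∀ Y : V, g X Y = 0) → X = 0)
    (ξ : V) (hξ : g ξ ξ = -1)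
    (η : V → ℝ) (hη : ∀ X, η X = g X ξ)
    (α lam mu : ℝ)
    (Dα Dlam Dmu : V →ₗ[ℝ] ℝ)
    (T : V → V → V → ℝ)
    (hT : ∀ X Y Z, T X Y Z =
      -(Dα X + Dlam X) * g Y Z - (Dα X + Dmu X) * η Y * η Z
      - α * (α + mu) * (g X Y * η Z + g X Z * η Y + 2 * η X * η Y * η Z))
    (hcodazzi : ∀ X Y Z, T X Y Z = T Y X Z) :
    ∀ X Y, (Dlam X - Dmu X) * η Y = (Dlam Y - Dmu Y) * η X := by
  intro X Y
  have hηξ : η ξ = -1 := (hη ξ).trans hξ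
  have h := hcodazzi X Y ξ
  rw [hT, hT, ← hη X, ← hη Y, hηξ, hg_symm Y X] at h
  linear_combination -h
end

section
/- Let V be a real vector space of finite dimension n ≥ 2, g a nondegenerate symmetric bilinear form on V, ξ ∈ V with g(ξ,ξ) = -1, and η the linear functional η(X) := g(X,ξ). Let α, ρ, λ, μ be real numbers with μ - λ = (n-1)(α²-ρ), let S(X,Y) := -(α+λ)g(X,Y) - (α+μ)η(X)η(Y), and let R : V×V×V → V be a trilinear map satisfying, for all X,Y,Z,W ∈ V: g(R(X,Y)Z,W) = -g(R(X,Y)W,Z), R(X,Y)ξ = (α²-ρ)(η(Y)X - η(X)Y), and η(R(X,Y)Z) = (α²-ρ)(η(X)g(Y,Z) - η(Y)g(X,Z)). If S(R(ξ,X)Y,Z) + S(Y,R(ξ,X)Z) = 0 for all X,Y,Z ∈ V, then either (μ = -α and λ = -α - (n-1)(α²-ρ)) or (λ = μ and α²-ρ = 0). -/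
/-- If the trilinear curvature map `R` satisfies the (LCS)ₙ identities and
`S(R(ξ,X)Y,Z) + S(Y,R(ξ,X)Z) = 0` for all `X,Y,Z`, then either `μ = -α` and
`λ = -α - (n-1)(α²-ρ)`, or `λ = μ` and `α²-ρ = 0`. -/
theorem stmt_5 (V : Type*) [AddCommGroup V] [Module ℝ V] [FiniteDimensional ℝ V]
    (n : ℕ) (hn : 2 ≤ n) (hdim : Module.finrank ℝ V = n)
    (g : LinearMap.BilinForm ℝ V)
    (hg_symm : ∀ X Y : V, g X Y = g Y X)
    (hg_nd : ∀ X : V, (∀ Y : V, g X Y = 0) → X = 0)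
    (ξ : V) (hξ : g ξ ξ = -1)
    (η : V → ℝ) (hη : ∀ X, η X = g X ξ)
    (α ρ lam mu : ℝ) (hml : mu - lam = ((n : ℝ) - 1) * (α ^ 2 - ρ))
    (S : V → V → ℝ)
    (hS : ∀ X Y, S X Y = -(α + lam) * g X Y - (α + mu) * η X * η Y)
    (R : V →ₗ[ℝ] V →ₗ[ℝ] V →ₗ[ℝ] V)
    (hR1 : ∀ X Y Z W : V, g (R X Y Z) W = -g (R X Y W) Z)
    (hR2 : ∀ X Y : V, R X Y ξ = (α ^ 2 - ρ) • (η Y • X - η X • Y))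
    (hR3 : ∀ X Y Z : V, η (R X Y Z) = (α ^ 2 - ρ) * (η X * g Y Z - η Y * g X Z))
    (hcond : ∀ X Y Z : V, S (R ξ X Y) Z + S Y (R ξ X Z) = 0) :
    (mu = -α ∧ lam = -α - ((n : ℝ) - 1) * (α ^ 2 - ρ)) ∨ (lam = mu ∧ α ^ 2 - ρ = 0) := by
  have hηξ : η ξ = -1 := by rw [hη, hξ]
  have hkey : ∀ X Y : V, (α + mu) * (α ^ 2 - ρ) * (g X Y + η X * η Y) = 0 := by
    intro X Y
    have h := hcond X Y ξ
    rw [hS, hS, hR3, hR3, hηξ, hR1 ξ X Y ξ, hg_symm Y (R ξ X ξ), hg_symm ξ Y, ← hη Y,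
      ← hη X, hξ] at h
    linear_combination -h
  have hprod : (α + mu) * (α ^ 2 - ρ) = 0 := by
    by_contra hne
    have hspan : ∀ X : V, (-η X) • ξ = X := by
      intro X
      have hX : X + η X • ξ = 0 := by
        refine hg_nd _ fun Y => ?_
        have h := (mul_eq_zero.mp (hkey X Y)).resolve_left hne
        rw [map_add, map_smul, LinearMap.add_apply, LinearMap.smul_apply, smul_eq_mul,
          hg_symm ξ Y, ← hη Y, h]
      rw [neg_smul, eq_comm]
      exact eq_neg_of_add_eq_zero_left hX
    have hle : Module.finrank ℝ V ≤ 1 := finrank_le_one ξ fun X => ⟨-η X, hspan X⟩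
    omega
  rcases mul_eq_zero.mp hprod with h | h
  · left
    constructor <;> linarith
  · right
    rw [h] at hml
    exact ⟨by linarith, h⟩
end

section
/- Let V be a real vector space of finite dimension n ≥ 2, g a nondegenerate symmetric bilinear form on V, ξ ∈ V with g(ξ,ξ) = -1, and η the linear functional η(X) := g(X,ξ). Let α, ρ, λ be real numbers with α ≠ 0 and -λ = (n-1)(α²-ρ) (the case μ = 0), let S(X,Y) := -(α+λ)g(X,Y) - α·η(X)η(Y), and let R : V×V×V → V be a trilinear map satisfying, for all X,Y,Z,W ∈ V: g(R(X,Y)Z,W) = -g(R(X,Y)W,Z), R(X,Y)ξ = (α²-ρ)(η(Y)X - η(X)Y), and η(R(X,Y)Z) = (α²-ρ)(η(X)g(Y,Z) - η(Y)g(X,Z)). If S(R(ξ,X)Y,Z) + S(Y,R(ξ,X)Z) = 0 for all X,Y,Z ∈ V, then λ = 0. -/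
/-- In the case `μ = 0` (Ricci soliton), with `α ≠ 0`, `-λ = (n-1)(α²-ρ)`,
`S(X,Y) := -(α+λ)g(X,Y) - α·η(X)η(Y)`, and the (LCS)ₙ curvature identities, the condition
`S(R(ξ,X)Y,Z) + S(Y,R(ξ,X)Z) = 0` forces `λ = 0` (the soliton is steady). -/
theorem stmt_6 (V : Type*) [AddCommGroup V] [Module ℝ V] [FiniteDimensional ℝ V]
    (n : ℕ) (hn : 2 ≤ n) (hdim : Module.finrank ℝ V = n)
    (g : LinearMap.BilinForm ℝ V)
    (hg_symm : ∀ X Y : V, g X Y = g Y X)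
    (hg_nd : ∀ X : V, (∀ Y : V, g X Y = 0) → X = 0)
    (ξ : V) (hξ : g ξ ξ = -1)
    (η : V → ℝ) (hη : ∀ X, η X = g X ξ)
    (α ρ lam : ℝ) (hα : α ≠ 0) (hml : -lam = ((n : ℝ) - 1) * (α ^ 2 - ρ))
    (S : V → V → ℝ)
    (hS : ∀ X Y, S X Y = -(α + lam) * g X Y - α * η X * η Y)
    (R : V →ₗ[ℝ] V →ₗ[ℝ] V →ₗ[ℝ] V)
    (hR1 : ∀ X Y Z W : V, g (R X Y Z) W = -g (R X Y W) Z)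
    (hR2 : ∀ X Y : V, R X Y ξ = (α ^ 2 - ρ) • (η Y • X - η X • Y))
    (hR3 : ∀ X Y Z : V, η (R X Y Z) = (α ^ 2 - ρ) * (η X * g Y Z - η Y * g X Z))
    (hcond : ∀ X Y Z : V, S (R ξ X Y) Z + S Y (R ξ X Z) = 0) :
    lam = 0 := by
  have hηξ : η ξ = -1 := by rw [hη, hξ]
  have hηR : ∀ X Y : V, η (R ξ X Y) = -((α ^ 2 - ρ) * (g X Y + η X * η Y)) := by
    intro X Y
    rw [hR3, hηξ, hg_symm ξ Y, ← hη]
    ring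
  have hproj : ∀ X Y : V, (α ^ 2 - ρ) * (g X Y + η X * η Y) = 0 := by
    intro X Y
    have h := hcond X Y ξ
    rw [hS, hS, hηR, hηR, hg_symm Y, hR1 ξ X Y ξ, ← hη X, hηξ] at h
    have h' : α * ((α ^ 2 - ρ) * (g X Y + η X * η Y)) = 0 := by linear_combination -h
    exact (mul_eq_zero.mp h').resolve_left hα
  have hc : α ^ 2 - ρ = 0 := by
    by_contra hc
    have hspan : ∀ X : V, ∃ c : ℝ, c • ξ = X := by
      intro X
      refine ⟨-η X, ?_⟩
      have h0 : X + η X • ξ = 0 := by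
        refine hg_nd _ fun Y => ?_
        have h := (mul_eq_zero.mp (hproj X Y)).resolve_left hc
        rw [map_add, map_smul, LinearMap.add_apply, LinearMap.smul_apply, smul_eq_mul,
          hg_symm ξ Y, ← hη]
        exact h
      rw [neg_smul]
      exact (eq_neg_of_add_eq_zero_left h0).symm
    have := finrank_le_one ξ hspan
    omega
  rw [hc, mul_zero] at hml
  linarith
end

section
/- Let V be a real vector space of finite dimension n ≥ 2, g a nondegenerate symmetric bilinear form on V, ξ ∈ V with g(ξ,ξ) = -1, and η the linear functional η(X) := g(X,ξ). Let α, ρ, λ, μ be real numbers with μ - λ = (n-1)(α²-ρ) and α²-ρ ≠ 0, let S(X,Y) := -(α+λ)g(X,Y) - (α+μ)η(X)η(Y), and let R : V×V×V → V be a trilinear map satisfying, for all X,Y,Z,W ∈ V: g(R(X,Y)Z,W) = -g(R(X,Y)W,Z), R(X,Y)ξ = (α²-ρ)(η(Y)X - η(X)Y), and η(R(X,Y)Z) = (α²-ρ)(η(X)g(Y,Z) - η(Y)g(X,Z)). If S(R(ξ,X)Y,Z) + S(Y,R(ξ,X)Z) = 0 for all X,Y,Z ∈ V, then S(X,Y)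 = (n-1)(α²-ρ)g(X,Y) for all X,Y, and the trace of the Ricci operator Q (the unique endomorphism with g(QX,Y) = S(X,Y)) equals n(n-1)(α²-ρ). -/
/-- With `μ - λ = (n-1)(α²-ρ)`, `α²-ρ ≠ 0`, the (LCS)ₙ curvature identities and
the condition `S(R(ξ,X)Y,Z) + S(Y,R(ξ,X)Z) = 0`, one has `S = (n-1)(α²-ρ)g` and the trace of
the Ricci operator equals `n(n-1)(α²-ρ)`. -/
theorem stmt_7 (V : Type*) [AddCommGroup V] [Module ℝ V] [FiniteDimensional ℝ V]
    (n : ℕ) (hn : 2 ≤ n) (hdim : Module.finrank ℝ V = n)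
    (g : LinearMap.BilinForm ℝ V)
    (hg_symm : ∀ X Y : V, g X Y = g Y X)
    (hg_nd : ∀ X : V, (∀ Y : V, g X Y = 0) → X = 0)
    (ξ : V) (hξ : g ξ ξ = -1)
    (η : V → ℝ) (hη : ∀ X, η X = g X ξ)
    (α ρ lam mu : ℝ) (hml : mu - lam = ((n : ℝ) - 1) * (α ^ 2 - ρ))
    (hαρ : α ^ 2 - ρ ≠ 0)
    (S : V → V → ℝ)
    (hS : ∀ X Y, S X Y = -(α + lam) * g X Y - (α + mu) * η X * η Y)
    (R : V →ₗ[ℝ] V →ₗ[ℝ] V →ₗ[ℝ] V)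
    (hR1 : ∀ X Y Z W : V, g (R X Y Z) W = -g (R X Y W) Z)
    (hR2 : ∀ X Y : V, R X Y ξ = (α ^ 2 - ρ) • (η Y • X - η X • Y))
    (hR3 : ∀ X Y Z : V, η (R X Y Z) = (α ^ 2 - ρ) * (η X * g Y Z - η Y * g X Z))
    (hcond : ∀ X Y Z : V, S (R ξ X Y) Z + S Y (R ξ X Z) = 0)
    (Q : V →ₗ[ℝ] V) (hQ : ∀ X Y, g (Q X) Y = S X Y) :
    (∀ X Y, S X Y = ((n : ℝ) - 1) * (α ^ 2 - ρ) * g X Y) ∧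
      LinearMap.trace ℝ V Q = n * ((n : ℝ) - 1) * (α ^ 2 - ρ) := by
  have hηξ : η ξ = -1 := by rw [hη, hξ]
  have hmu : α + mu = 0 := by
    by_contra hne
    have key : ∀ X Y, g X Y + η X * η Y = 0 := by
      intro X Y
      have h := hcond X Y ξ
      rw [hS, hS, hR3, hR3, hR1 ξ X Y ξ, hηξ, hg_symm ξ Y, hξ, ← hη, ← hη,
        hg_symm Y (R ξ X ξ)] at h
      have h' : (α + mu) * (α ^ 2 - ρ) * (g X Y + η X * η Y) = 0 := by linear_combination -h
      exact (mul_eq_zero.mp h').resolve_left (mul_ne_zero hne hαρ)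
    have hspan : ∀ X : V, ∃ c : ℝ, c • ξ = X := by
      intro X
      refine ⟨-η X, ?_⟩
      have h0 : X + η X • ξ = 0 := by
        refine hg_nd _ fun Y => ?_
        rw [map_add, map_smul, LinearMap.add_apply, LinearMap.smul_apply, smul_eq_mul,
          hg_symm ξ Y, ← hη]
        exact key X Y
      rw [neg_smul, ← eq_neg_of_add_eq_zero_left h0]
    have hle := finrank_le_one ξ hspan
    omega
  have hSg : ∀ X Y, S X Y = ((n : ℝ) - 1) * (α ^ 2 - ρ) * g X Y := by
    intro X Y
    rw [hS]
    linear_combination (g X Y) * hml - (g X Y + η X * η Y) * hmu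
  refine ⟨hSg, ?_⟩
  have hQid : Q = (((n : ℝ) - 1) * (α ^ 2 - ρ)) • LinearMap.id := by
    ext X
    refine sub_eq_zero.mp (hg_nd _ fun Y => ?_)
    simp [hQ, hSg]
  rw [hQid, map_smul, LinearMap.trace_id, hdim, smul_eq_mul]
  ring
end

section
/- Let V be a real vector space of finite dimension n ≥ 2, g a nondegenerate symmetric bilinear form on V, ξ ∈ V with g(ξ,ξ) = -1, and η the linear functional η(X) := g(X,ξ). Let α, ρ, λ, μ be real numbers with μ - λ = (n-1)(α²-ρ), let S(X,Y) := -(α+λ)g(X,Y) - (α+μ)η(X)η(Y), and let R : V×V×V → V be a trilinear map satisfying, for all X,Y,Z,W ∈ V: R(X,Y)Z = -R(Y,X)Z, g(R(X,Y)Z,W) = -g(R(X,Y)W,Z), R(X,Y)ξ = (α²-ρ)(η(Y)X - η(X)Y), and η(R(X,Y)Z) = (α²-ρ)(η(X)g(Y,Z) - η(Y)g(X,Z)). Suppose that for all X,Y,Z,W ∈ V: S(X,R(Y,Z)W)ξ - S(ξ,R(Y,Z)W)X + S(X,Y)R(ξ,Z)W - S(ξ,Y)R(X,Z)W + S(X,Z)R(Y,ξ)W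 - S(ξ,Z)R(Y,X)W + S(X,W)R(Y,Z)ξ - S(ξ,W)R(Y,Z)X = 0. Then either (μ = -α + 2(n-1)(α²-ρ) and λ = -α + (n-1)(α²-ρ)) or α²-ρ = 0. -/
/-- If `g ξ ξ = -1` and `g` is nondegenerate on a space of dimension at least two, there are
`u`, `v` orthogonal to `ξ` with `g u v ≠ 0`. -/
theorem exists_orthogonal_pair_apply_ne_zero {V : Type*} [AddCommGroup V] [Module ℝ V]
    [FiniteDimensional ℝ V] (hdim : 1 < Module.finrank ℝ V) (g : LinearMap.BilinForm ℝ V)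
    (hg_symm : ∀ X Y : V, g X Y = g Y X) (hg_nd : ∀ X : V, (∀ Y : V, g X Y = 0) → X = 0)
    (ξ : V) (hξ : g ξ ξ = -1) :
    ∃ u v : V, g u ξ = 0 ∧ g v ξ = 0 ∧ g u v ≠ 0 := by
  have hker : LinearMap.ker (g ξ) ≠ ⊥ := LinearMap.ker_ne_bot_of_finrank_lt (by simpa using hdim)
  obtain ⟨u, hu, hu0⟩ := (Submodule.ne_bot_iff _).1 hker
  have huξ : g u ξ = 0 := by rw [hg_symm]; exact hu
  obtain ⟨v, hv⟩ : ∃ v, g u v ≠ 0 := by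
    by_contra! h
    exact hu0 (hg_nd u h)
  exact ⟨u, v + g v ξ • ξ, huξ, by simp [hξ], by simpa [huξ] using hv⟩

/-- With `μ - λ = (n-1)(α²-ρ)`, the (LCS)ₙ curvature identities and the 8-term
condition `(ξ,·)_S · R = 0`, either `μ = -α + 2(n-1)(α²-ρ)` and `λ = -α + (n-1)(α²-ρ)`, or
`α²-ρ = 0`. -/
theorem stmt_9 (V : Type*) [AddCommGroup V] [Module ℝ V] [FiniteDimensional ℝ V]
    (n : ℕ) (hn : 2 ≤ n) (hdim : Module.finrank ℝ V = n)
    (g : LinearMap.BilinForm ℝ V)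
    (hg_symm : ∀ X Y : V, g X Y = g Y X)
    (hg_nd : ∀ X : V, (∀ Y : V, g X Y = 0) → X = 0)
    (ξ : V) (hξ : g ξ ξ = -1)
    (η : V → ℝ) (hη : ∀ X, η X = g X ξ)
    (α ρ lam mu : ℝ) (hml : mu - lam = ((n : ℝ) - 1) * (α ^ 2 - ρ))
    (S : V → V → ℝ)
    (hS : ∀ X Y, S X Y = -(α + lam) * g X Y - (α + mu) * η X * η Y)
    (R : V →ₗ[ℝ] V →ₗ[ℝ] V →ₗ[ℝ] V)
    (hR0 : ∀ X Y Z : V, R X Y Z = -R Y X Z)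
    (hR1 : ∀ X Y Z W : V, g (R X Y Z) W = -g (R X Y W) Z)
    (hR2 : ∀ X Y : V, R X Y ξ = (α ^ 2 - ρ) • (η Y • X - η X • Y))
    (hR3 : ∀ X Y Z : V, η (R X Y Z) = (α ^ 2 - ρ) * (η X * g Y Z - η Y * g X Z))
    (hcond : ∀ X Y Z W : V,
      S X (R Y Z W) • ξ - S ξ (R Y Z W) • X + S X Y • R ξ Z W - S ξ Y • R X Z W
      + S X Z • R Y ξ W - S ξ Z • R Y X W + S X W • R Y Z ξ - S ξ W • R Y Z X = 0) :
    (mu = -α + 2 * ((n : ℝ) - 1) * (α ^ 2 - ρ) ∧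
      lam = -α + ((n : ℝ) - 1) * (α ^ 2 - ρ)) ∨ α ^ 2 - ρ = 0 := by
  by_cases hk : α ^ 2 - ρ = 0
  · exact Or.inr hk
  obtain ⟨u, v, hu, hv, huv⟩ :=
    exists_orthogonal_pair_apply_ne_zero (by omega) g hg_symm hg_nd ξ hξ
  have hηξ : η ξ = -1 := by rw [hη, hξ]
  have hηu : η u = 0 := by rw [hη, hu]
  have hηv : η v = 0 := by rw [hη, hv]
  have hξu : g ξ u = 0 := by rw [hg_symm, hu]
  have hR3v : g (R u ξ v) ξ = (α ^ 2 - ρ) * g u v := by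
    rw [← hη, hR3, hηu, hηξ]; ring
  have h := congrArg (fun x => g x ξ) (hcond v u ξ ξ)
  simp only [hR2, hS, hηξ, hηu, hηv, hR3v, hξu, hu, hv, hξ, hg_symm v u, map_add, map_sub,
    map_smul, map_zero, LinearMap.add_apply, LinearMap.sub_apply, LinearMap.smul_apply,
    LinearMap.zero_apply, smul_eq_mul] at h
  have hlam : α + lam = mu - lam :=
    mul_right_cancel₀ (mul_ne_zero hk huv) (by linear_combination -h)
  exact Or.inl ⟨by linear_combination hlam + 2 * hml, by linear_combination hlam + hml⟩
end

section
/- Let V be a real vector space of finite dimension n ≥ 2, g a nondegenerate symmetric bilinear form on V, ξ ∈ V with g(ξ,ξ) = -1, and η the linear functional η(X) := g(X,ξ). Let α, ρ, λ, μ be real numbers with μ - λ = (n-1)(α²-ρ) and α²-ρ ≠ 0, let S(X,Y) := -(α+λ)g(X,Y) - (α+μ)η(X)η(Y), and let R : V×V×V → V be a trilinear map satisfying, for all X,Y,Z,W ∈ V: R(X,Y)Z = -R(Y,X)Z, g(R(X,Y)Z,W) = -g(R(X,Y)W,Z), R(X,Y)ξ = (α²-ρ)(η(Y)X - η(X)Y),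 and η(R(X,Y)Z) = (α²-ρ)(η(X)g(Y,Z) - η(Y)g(X,Z)). Suppose that for all X,Y,Z,W ∈ V: S(X,R(Y,Z)W)ξ - S(ξ,R(Y,Z)W)X + S(X,Y)R(ξ,Z)W - S(ξ,Y)R(X,Z)W + S(X,Z)R(Y,ξ)W - S(ξ,Z)R(Y,X)W + S(X,W)R(Y,Z)ξ - S(ξ,W)R(Y,Z)X = 0. Then S(X,Y) = -(n-1)(α²-ρ)(g(X,Y) + 2η(X)η(Y)) for all X,Y, and the trace of the Ricci operator Q (the unique endomorphism with g(QX,Y) = S(X,Y)) equals -(n-1)(n-2)(α²-ρ). -/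
/-- With `μ - λ = (n-1)(α²-ρ)`, `α²-ρ ≠ 0`, the (LCS)ₙ curvature identities
and the 8-term condition `(ξ,·)_S · R = 0`, one has `S = -(n-1)(α²-ρ)(g + 2η⊗η)` and the
trace of the Ricci operator equals `-(n-1)(n-2)(α²-ρ)`. -/
theorem stmt_11 (V : Type*) [AddCommGroup V] [Module ℝ V] [FiniteDimensional ℝ V]
    (n : ℕ) (hn : 2 ≤ n) (hdim : Module.finrank ℝ V = n)
    (g : LinearMap.BilinForm ℝ V)
    (hg_symm : ∀ X Y : V, g X Y = g Y X)
    (hg_nd : ∀ X : V, (∀ Y : V, g X Y = 0) → X = 0)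
    (ξ : V) (hξ : g ξ ξ = -1)
    (η : V → ℝ) (hη : ∀ X, η X = g X ξ)
    (α ρ lam mu : ℝ) (hml : mu - lam = ((n : ℝ) - 1) * (α ^ 2 - ρ))
    (hαρ : α ^ 2 - ρ ≠ 0)
    (S : V → V → ℝ)
    (hS : ∀ X Y, S X Y = -(α + lam) * g X Y - (α + mu) * η X * η Y)
    (R : V →ₗ[ℝ] V →ₗ[ℝ] V →ₗ[ℝ] V)
    (hR0 : ∀ X Y Z : V, R X Y Z = -R Y X Z)
    (hR1 : ∀ X Y Z W : V, g (R X Y Z) W = -g (R X Y W) Z)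
    (hR2 : ∀ X Y : V, R X Y ξ = (α ^ 2 - ρ) • (η Y • X - η X • Y))
    (hR3 : ∀ X Y Z : V, η (R X Y Z) = (α ^ 2 - ρ) * (η X * g Y Z - η Y * g X Z))
    (hcond : ∀ X Y Z W : V,
      S X (R Y Z W) • ξ - S ξ (R Y Z W) • X + S X Y • R ξ Z W - S ξ Y • R X Z W
      + S X Z • R Y ξ W - S ξ Z • R Y X W + S X W • R Y Z ξ - S ξ W • R Y Z X = 0)
    (Q : V →ₗ[ℝ] V) (hQ : ∀ X Y, g (Q X) Y = S X Y) :
    (∀ X Y, S X Y = -(((n : ℝ) - 1) * (α ^ 2 - ρ)) * (g X Y + 2 * η X * η Y)) ∧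
      LinearMap.trace ℝ V Q = -(((n : ℝ) - 1) * ((n : ℝ) - 2) * (α ^ 2 - ρ)) := by
  have hξξ : η ξ = -1 := by rw [hη, hξ]
  obtain ⟨v, hv⟩ : ∃ v : V, ∀ r : ℝ, r • ξ ≠ v := by
    by_contra! h
    have := finrank_le_one ξ h
    omega
  have hproj (x : V) : g (x + η x • ξ) ξ = 0 := by
    simp [hξ, hη]
  -- Projecting orthogonally to `ξ` gives `x`, `z` in `ξᗮ` with `g z x ≠ 0`.
  obtain ⟨x, z, hx, hz, hzx⟩ : ∃ x z : V, g x ξ = 0 ∧ g z ξ = 0 ∧ g z x ≠ 0 := by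
    have hz0 : v + η v • ξ ≠ 0 := fun h ↦
      hv (-η v) (by rw [neg_smul]; exact (eq_neg_of_add_eq_zero_left h).symm)
    obtain ⟨y, hy⟩ : ∃ y, g (v + η v • ξ) y ≠ 0 := by
      by_contra! h
      exact hz0 (hg_nd _ h)
    refine ⟨y + η y • ξ, v + η v • ξ, hproj y, hproj v, ?_⟩
    rwa [map_add, map_smul, hproj v, smul_zero, add_zero]
  have hηz : η z = 0 := by rw [hη, hz]
  have hgξz : g ξ z = 0 := by rw [hg_symm, hz]
  have hgR : g (R ξ z x) ξ = -((α ^ 2 - ρ) * g z x) := by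
    rw [← hη, hR3, hξξ, hηz]; ring
  have ha : α + lam = ((n : ℝ) - 1) * (α ^ 2 - ρ) := by
    have h := congrArg (fun u ↦ g u ξ) (hcond x ξ z ξ)
    simp only [hR2, hS, hη, hx, hz, hξ, hgξz, hg_symm x z, map_add, map_sub,
      map_smul, map_zero, LinearMap.add_apply, LinearMap.sub_apply, LinearMap.smul_apply,
      LinearMap.zero_apply, smul_eq_mul, hgR] at h
    have hk : (α ^ 2 - ρ) * g z x ≠ 0 := mul_ne_zero hαρ hzx
    apply mul_left_cancel₀ hk
    linear_combination h + (α ^ 2 - ρ) * g z x * hml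
  have hb : α + mu = 2 * (((n : ℝ) - 1) * (α ^ 2 - ρ)) := by linarith
  have hSform (X Y : V) :
      S X Y = -(((n : ℝ) - 1) * (α ^ 2 - ρ)) * (g X Y + 2 * η X * η Y) := by
    rw [hS, ha, hb]; ring
  refine ⟨hSform, ?_⟩
  have hQeq : Q = -(((n : ℝ) - 1) * (α ^ 2 - ρ)) •
      (LinearMap.id + (2 : ℝ) • (g ξ).smulRight ξ) := by
    ext X
    refine sub_eq_zero.mp (hg_nd _ fun Y ↦ ?_)
    simp only [map_sub, LinearMap.sub_apply, hQ, hSform, hη, LinearMap.smul_apply,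
      LinearMap.add_apply, LinearMap.id_apply, LinearMap.smulRight_apply, map_smul, map_add,
      smul_eq_mul, hg_symm ξ]
    ring
  rw [hQeq, map_smul, map_add, map_smul, LinearMap.trace_id, LinearMap.trace_smulRight, hdim, hξ]
  simp only [smul_eq_mul]
  ring
end

section
/- Let V be a real vector space of finite dimension n ≥ 1 and g a nondegenerate symmetric bilinear form on V. For a symmetric bilinear form T on V, let Q_T denote the unique linear endomorphism of V with g(Q_T X, Y) = T(X,Y) for all X,Y, and write |T|² := trace(Q_T ∘ Q_T). Let H and S be symmetric bilinear forms on V, ξ ∈ V, η the linear functional η(X) := g(X,ξ), and λ, μ real numbers such that H(X,Y) + S(X,Y) + λ g(X,Y) + μ η(X)η(Y) = 0 for all X,Y ∈ V. Set Δ := trace(Q_H), scal := trace(Q_S), and k := g(ξ,ξ). Then |H|² + μ²k² + 2μH(ξ,ξ) - (Δ + μk)²/n ≤ |S|² ≤ |H|² + μ²k² + 2μH(ξ,ξ) + scal²/n. -/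
/-- Pointwise norm bounds for a gradient almost η-Ricci soliton. With symmetric
bilinear forms `H`, `S` on `(V,g)` satisfying `H + S + λg + μη⊗η = 0` (where `η = g(·,ξ)`),
`|T|² := trace(Q_T∘Q_T)` for `Q_T` the `g`-representing endomorphism, `Δ := trace Q_H`,
`scal := trace Q_S` and `k := g(ξ,ξ)`:
`|H|² + μ²k² + 2μH(ξ,ξ) - (Δ+μk)²/n ≤ |S|² ≤ |H|² + μ²k² + 2μH(ξ,ξ) + scal²/n`. -/
theorem stmt_14 (V : Type*) [AddCommGroup V] [Module ℝ V] [FiniteDimensional ℝ V]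
    (n : ℕ) (hn : 1 ≤ n) (hdim : Module.finrank ℝ V = n)
    (g : LinearMap.BilinForm ℝ V)
    (hg_symm : ∀ X Y : V, g X Y = g Y X)
    (hg_nd : ∀ X : V, (∀ Y : V, g X Y = 0) → X = 0)
    (H S : LinearMap.BilinForm ℝ V)
    (hH_symm : ∀ X Y : V, H X Y = H Y X)
    (hS_symm : ∀ X Y : V, S X Y = S Y X)
    (ξ : V) (η : V → ℝ) (hη : ∀ X, η X = g X ξ)
    (lam mu : ℝ)
    (hsol : ∀ X Y : V, H X Y + S X Y + lam * g X Y + mu * η X * η Y = 0)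
    (QH QS : V →ₗ[ℝ] V)
    (hQH : ∀ X Y, g (QH X) Y = H X Y)
    (hQS : ∀ X Y, g (QS X) Y = S X Y)
    (Δ scal k normH2 normS2 : ℝ)
    (hΔ : Δ = LinearMap.trace ℝ V QH)
    (hscal : scal = LinearMap.trace ℝ V QS)
    (hk : k = g ξ ξ)
    (hnormH2 : normH2 = LinearMap.trace ℝ V (QH ∘ₗ QH))
    (hnormS2 : normS2 = LinearMap.trace ℝ V (QS ∘ₗ QS)) :
    normH2 + mu ^ 2 * k ^ 2 + 2 * mu * H ξ ξ - (Δ + mu * k) ^ 2 / n ≤ normS2 ∧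
      normS2 ≤ normH2 + mu ^ 2 * k ^ 2 + 2 * mu * H ξ ξ + scal ^ 2 / n := by
  set P : V →ₗ[ℝ] V := (g ξ).smulRight ξ with hP
  have hQ : QS = -(QH + mu • P + lam • LinearMap.id) := by
    ext X
    refine sub_eq_zero.mp (hg_nd _ fun Y => ?_)
    have h := hsol X Y
    rw [hη, hη, hg_symm X ξ, hg_symm Y ξ] at h
    simp only [hP, LinearMap.neg_apply, LinearMap.add_apply, LinearMap.smul_apply,
      LinearMap.smulRight_apply, LinearMap.id_apply, map_sub, map_neg, map_add, map_smul,
      LinearMap.sub_apply, smul_eq_mul, hQS, hQH]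
    linarith
  have htP : LinearMap.trace ℝ V P = k := by
    rw [hP, LinearMap.trace_smulRight, hk]
  have hPP : P ∘ₗ P = k • P := by
    ext X
    simp [hP, hk, smul_smul, mul_comm]
  have hHP : LinearMap.trace ℝ V (QH ∘ₗ P) = H ξ ξ := by
    have h : QH ∘ₗ P = (g ξ).smulRight (QH ξ) := by
      ext X
      simp [hP]
    rw [h, LinearMap.trace_smulRight, hg_symm, hQH]
  have hPH : LinearMap.trace ℝ V (P ∘ₗ QH) = H ξ ξ := by
    rw [LinearMap.trace_comp_comm', hHP]
  have htid : LinearMap.trace ℝ V LinearMap.id = (n : ℝ) := by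
    rw [LinearMap.trace_id, hdim]
  have hscal' : scal = -(Δ + mu * k + lam * n) := by
    rw [hscal, hQ]
    simp only [map_neg, map_add, map_smul, smul_eq_mul, htP, htid, ← hΔ]
  have hS2 : normS2 = normH2 + mu ^ 2 * k ^ 2 + 2 * mu * H ξ ξ
      + 2 * lam * (Δ + mu * k) + n * lam ^ 2 := by
    rw [hnormS2, hQ]
    simp only [LinearMap.neg_comp, LinearMap.comp_neg, map_neg, LinearMap.add_comp,
      LinearMap.comp_add, LinearMap.smul_comp, LinearMap.comp_smul, LinearMap.id_comp,
      LinearMap.comp_id, hPP, map_add, map_smul, smul_eq_mul, htP, htid, hHP, hPH,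
      ← hΔ, ← hnormH2]
    ring
  have hn' : (0 : ℝ) < n := by exact_mod_cast hn
  have hlow : 2 * lam * (Δ + mu * k) + n * lam ^ 2 + (Δ + mu * k) ^ 2 / n = scal ^ 2 / n := by
    rw [hscal']
    field_simp
    ring
  have hscal_nonneg : 0 ≤ scal ^ 2 / n := by positivity
  have htrace_nonneg : 0 ≤ (Δ + mu * k) ^ 2 / n := by positivity
  constructor <;> linarith
end
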